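/- Let δ > 0, r ∈ ℕ, b ∈ L_∞(ℝ), and 1 ≤ p < ∞. For μ ∈ ℂ with Re μ < δ, let K_μ be the bounded operator on L_p(ℝ) given by (K_μ φ)(t) = e^{−δ|t|} ∫_{−∞}^{t} e^{μ(t−s)} (t−s)^r e^{−δ|s|} b(s) φ(s) ds. Then the operator-valued function μ ↦ K_μ is analytic on the half-plane {μ ∈ ℂ : Re μ < δ}, i.e., it is complex differentiable in the operator norm of B(L_p(ℝ)) at every point of this half-plane. -/

import Mathlib

open MeasureTheory Filter Topology

lemma memLp_exp_neg_mul_abs {ε : ℝ} (hε : 0 < ε) (p : ENNReal) (hp : p ≠ 0) :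
    MemLp (fun t : ℝ => Real.exp (-ε * |t|)) p volume := by
  have hint : ∀ c : ℝ, 0 < c → Integrable (fun t : ℝ => Real.exp (-c * |t|)) volume := by
    intro c hc
    rw [← integrableOn_univ, ← Set.Iic_union_Ioi (a := (0 : ℝ)), integrableOn_union]
    constructor
    · refine (integrableOn_exp_mul_Iic hc 0).congr_fun (fun t ht => ?_) measurableSet_Iic
      simp [abs_of_nonpos (Set.mem_Iic.mp ht)]
    · refine (integrableOn_exp_mul_Ioi (neg_lt_zero.mpr hc) 0).congr_fun (fun t ht => ?_)
        measurableSet_Ioi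
      simp [abs_of_pos (Set.mem_Ioi.mp ht)]
  have hmeas : AEStronglyMeasurable (fun t : ℝ => Real.exp (-ε * |t|)) volume :=
    (by fun_prop : Continuous fun t : ℝ => Real.exp (-ε * |t|)).aestronglyMeasurable
  by_cases htop : p = ⊤
  · subst htop
    refine memLp_top_of_bound hmeas 1 (Eventually.of_forall fun t => ?_)
    rw [Real.norm_of_nonneg (Real.exp_nonneg _), Real.exp_le_one_iff]
    nlinarith [abs_nonneg t]
  · rw [← integrable_norm_rpow_iff hmeas hp htop]
    refine (hint (ε * p.toReal) (mul_pos hε (ENNReal.toReal_pos hp htop))).congr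
      (Eventually.of_forall fun t => ?_)
    simp only [Real.norm_eq_abs, Real.abs_exp, ← Real.exp_mul]
    ring_nf

lemma exists_integral_exp_mul_norm_le {ε : ℝ} (hε : 0 < ε) (p : ENNReal) [hp : Fact (1 ≤ p)] :
    ∃ M : ℝ, 0 ≤ M ∧ ∀ φ : Lp ℂ p (volume : Measure ℝ),
      Integrable (fun s : ℝ => Real.exp (-ε * |s|) * ‖φ s‖) volume ∧
        ∫ s : ℝ, Real.exp (-ε * |s|) * ‖φ s‖ ≤ M * ‖φ‖ := by
  have hconj : p.HolderConjugate p.conjExponent := .conjExponent hp.out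
  have hg : MemLp (fun t : ℝ => Real.exp (-ε * |t|)) p.conjExponent volume :=
    memLp_exp_neg_mul_abs hε _ (ENNReal.HolderConjugate.ne_zero _ p)
  refine ⟨(eLpNorm (fun t : ℝ => Real.exp (-ε * |t|)) p.conjExponent volume).toReal,
    ENNReal.toReal_nonneg, fun φ => ?_⟩
  have hφ : MemLp (fun s => ‖φ s‖) p volume := (Lp.memLp φ).norm
  have hint : Integrable (fun s : ℝ => Real.exp (-ε * |s|) * ‖φ s‖) volume :=
    hg.integrable_mul hφ
  refine ⟨hint, ?_⟩
  have hle := eLpNorm_smul_le_mul_eLpNorm (p := p.conjExponent) (q := p) (r := 1) hφ.1 hg.1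
  rw [eLpNorm_norm] at hle
  have heq : ∫ s : ℝ, Real.exp (-ε * |s|) * ‖φ s‖ =
      (eLpNorm (fun s : ℝ => Real.exp (-ε * |s|) * ‖φ s‖) 1 volume).toReal := by
    rw [eLpNorm_one_eq_lintegral_enorm, ← integral_norm_eq_lintegral_enorm hint.1]
    simp
  rw [heq, Lp.norm_def, ← ENNReal.toReal_mul]
  exact ENNReal.toReal_mono (ENNReal.mul_ne_top hg.eLpNorm_ne_top (Lp.eLpNorm_ne_top φ)) hle

lemma ae_norm_coeFn_le_norm (b : Lp ℂ ⊤ (volume : Measure ℝ)) :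
    ∀ᵐ s : ℝ, ‖b s‖ ≤ ‖b‖ := by
  filter_upwards [ae_le_eLpNormEssSup (f := (b : ℝ → ℂ)) (μ := volume)] with s hs
  rw [Lp.norm_def, eLpNorm_exponent_top, ← toReal_enorm]
  exact ENNReal.toReal_mono (by simpa using Lp.eLpNorm_ne_top b) hs

/-- The integrand of the weighted causal convolution operator with convolution kernel `f`. -/
noncomputable def causalIntegrand (δ : ℝ) (b : Lp ℂ ⊤ (volume : Measure ℝ)) (f : ℝ → ℂ)
    (φ : ℝ → ℂ) (t s : ℝ) : ℂ :=
  f (t - s) * (Real.exp (-δ * |s|) : ℂ) * b s * φ s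

section
variable {δ a C : ℝ} {b : Lp ℂ ⊤ (volume : Measure ℝ)} {f : ℝ → ℂ}

lemma norm_causalIntegrand_le (ha : 0 ≤ a) (hC : 0 ≤ C)
    (hf : ∀ x, 0 ≤ x → ‖f x‖ ≤ C * Real.exp (a * x)) (φ : ℝ → ℂ) {t s : ℝ} (hst : s ≤ t)
    (hb : ‖b s‖ ≤ ‖b‖) :
    ‖causalIntegrand δ b f φ t s‖ ≤
      C * ‖b‖ * Real.exp (a * |t|) * (Real.exp (-(δ - a) * |s|) * ‖φ s‖) := by
  have hx : t - s ≤ |t| + |s| := by linarith [le_abs_self t, neg_abs_le s]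
  have hexp : ‖f (t - s)‖ ≤ C * Real.exp (a * (|t| + |s|)) :=
    (hf _ (sub_nonneg.mpr hst)).trans (by gcongr)
  have hsplit : Real.exp (a * (|t| + |s|)) * Real.exp (-δ * |s|) =
      Real.exp (a * |t|) * Real.exp (-(δ - a) * |s|) := by
    rw [← Real.exp_add, ← Real.exp_add]; ring_nf
  calc ‖causalIntegrand δ b f φ t s‖
      = ‖f (t - s)‖ * Real.exp (-δ * |s|) * ‖b s‖ * ‖φ s‖ := by
        simp only [causalIntegrand, norm_mul, Complex.norm_real, Real.norm_eq_abs, Real.abs_exp]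
    _ ≤ C * Real.exp (a * (|t| + |s|)) * Real.exp (-δ * |s|) * ‖b‖ * ‖φ s‖ := by gcongr
    _ = C * (Real.exp (a * (|t| + |s|)) * Real.exp (-δ * |s|)) * ‖b‖ * ‖φ s‖ := by ring
    _ = _ := by rw [hsplit]; ring

variable {p : ENNReal} [hp : Fact (1 ≤ p)]

lemma integrableOn_causalIntegrand (ha : 0 ≤ a) (haδ : a < δ) (hC : 0 ≤ C) (hcont : Continuous f)
    (hf : ∀ x, 0 ≤ x → ‖f x‖ ≤ C * Real.exp (a * x)) (φ : Lp ℂ p (volume : Measure ℝ)) (t : ℝ) :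
    IntegrableOn (causalIntegrand δ b f φ t) (Set.Iic t) volume := by
  obtain ⟨M, -, hM⟩ := exists_integral_exp_mul_norm_le (sub_pos.mpr haδ) p
  refine Integrable.mono'
    (((hM φ).1.const_mul (C * ‖b‖ * Real.exp (a * |t|))).integrableOn) ?_ ?_
  · refine AEStronglyMeasurable.restrict ?_
    refine ((Continuous.aestronglyMeasurable ?_).mul (Lp.memLp b).1).mul (Lp.memLp φ).1
    fun_prop
  · filter_upwards [ae_restrict_mem measurableSet_Iic,
      ae_restrict_of_ae (ae_norm_coeFn_le_norm b)] with s hst hbs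
    exact norm_causalIntegrand_le ha hC hf φ hst hbs

lemma exists_opNorm_causal_le (ha : 0 ≤ a) (haδ : a < δ) (b : Lp ℂ ⊤ (volume : Measure ℝ))
    (p : ENNReal) [hp : Fact (1 ≤ p)] :
    ∃ N : ℝ, 0 ≤ N ∧ ∀ (C : ℝ) (f : ℝ → ℂ)
      (T : Lp ℂ p (volume : Measure ℝ) →L[ℂ] Lp ℂ p (volume : Measure ℝ)), 0 ≤ C →
      (∀ x, 0 ≤ x → ‖f x‖ ≤ C * Real.exp (a * x)) →
      (∀ φ, ∀ᵐ t : ℝ, T φ t =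
        (Real.exp (-δ * |t|) : ℂ) * ∫ s in Set.Iic t, causalIntegrand δ b f φ t s) →
      ‖T‖ ≤ C * N := by
  obtain ⟨M, hM0, hM⟩ := exists_integral_exp_mul_norm_le (sub_pos.mpr haδ) p
  have hg : MemLp (fun t : ℝ => Real.exp (-(δ - a) * |t|)) p volume :=
    memLp_exp_neg_mul_abs (sub_pos.mpr haδ) p (zero_lt_one.trans_le hp.out).ne'
  refine ⟨‖b‖ * M * ‖hg.toLp _‖, by positivity, fun C f T hC hf hT => ?_⟩
  refine T.opNorm_le_bound (by positivity) fun φ => ?_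
  have hae : ∀ᵐ t : ℝ, ‖T φ t‖ ≤ (C * ‖b‖ * (M * ‖φ‖)) * ‖hg.toLp _ t‖ := by
    filter_upwards [hT φ, hg.coeFn_toLp] with t ht hgt
    rw [ht, hgt, norm_mul, Complex.norm_real, Real.norm_eq_abs, Real.abs_exp, Real.norm_eq_abs,
      Real.abs_exp]
    have hint := (hM φ).1.const_mul (C * ‖b‖ * Real.exp (a * |t|))
    have hI : ‖∫ s in Set.Iic t, causalIntegrand δ b f φ t s‖ ≤
        C * ‖b‖ * Real.exp (a * |t|) * (M * ‖φ‖) := by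
      calc _ ≤ ∫ s in Set.Iic t,
            C * ‖b‖ * Real.exp (a * |t|) * (Real.exp (-(δ - a) * |s|) * ‖φ s‖) := by
            refine norm_integral_le_of_norm_le hint.integrableOn ?_
            filter_upwards [ae_restrict_mem measurableSet_Iic,
              ae_restrict_of_ae (ae_norm_coeFn_le_norm b)] with s hst hbs
            exact norm_causalIntegrand_le ha hC hf φ hst hbs
        _ ≤ ∫ s, C * ‖b‖ * Real.exp (a * |t|) * (Real.exp (-(δ - a) * |s|) * ‖φ s‖) :=
            setIntegral_le_integral hint (Eventually.of_forall fun s => by positivity)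
        _ ≤ _ := by
            rw [integral_const_mul]
            exact mul_le_mul_of_nonneg_left (hM φ).2 (by positivity)
    have hsplit : Real.exp (-δ * |t|) * Real.exp (a * |t|) = Real.exp (-(δ - a) * |t|) := by
      rw [← Real.exp_add]; ring_nf
    calc _ ≤ Real.exp (-δ * |t|) * (C * ‖b‖ * Real.exp (a * |t|) * (M * ‖φ‖)) := by gcongr
      _ = C * ‖b‖ * (M * ‖φ‖) * (Real.exp (-δ * |t|) * Real.exp (a * |t|)) := by ring
      _ = _ := by rw [hsplit]
  calc ‖T φ‖ ≤ (C * ‖b‖ * (M * ‖φ‖)) * ‖hg.toLp _‖ := Lp.norm_le_mul_norm_of_ae_le_mul hae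
    _ = _ := by ring

end

lemma exists_pow_mul_exp_le {a c : ℝ} (hac : a < c) (n : ℕ) :
    ∃ C : ℝ, 0 ≤ C ∧ ∀ x : ℝ, 0 ≤ x → x ^ n * Real.exp (a * x) ≤ C * Real.exp (c * x) := by
  have hca : 0 < c - a := sub_pos.mpr hac
  refine ⟨n.factorial / (c - a) ^ n, by positivity, fun x hx => ?_⟩
  have h := Real.pow_div_factorial_le_exp ((c - a) * x) (by positivity) n
  rw [div_le_iff₀ (by positivity), mul_pow] at h
  have hsplit : Real.exp (c * x) = Real.exp ((c - a) * x) * Real.exp (a * x) := by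
    rw [← Real.exp_add]; ring_nf
  rw [hsplit, ← mul_assoc]
  gcongr
  rw [div_mul_eq_mul_div, le_div_iff₀ (by positivity)]
  linarith

lemma norm_slope_exp_sub_le {μ z : ℂ} (hz : z ≠ μ) {x : ℝ} (hx : 0 ≤ x) :
    ‖slope (fun w : ℂ => Complex.exp (w * x)) μ z - x * Complex.exp (μ * x)‖ ≤
      ‖z - μ‖ * (x ^ 2 * Real.exp ((μ.re + ‖z - μ‖) * x)) := by
  have hne : z - μ ≠ 0 := sub_ne_zero.mpr hz
  have hexp : Complex.exp (z * x) = Complex.exp (μ * x) * Complex.exp ((z - μ) * x) := by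
    rw [← Complex.exp_add]; ring_nf
  have heq : slope (fun w : ℂ => Complex.exp (w * x)) μ z - x * Complex.exp (μ * x) =
      (z - μ)⁻¹ * (Complex.exp (μ * x) * (Complex.exp ((z - μ) * x) - (1 + (z - μ) * x))) := by
    rw [slope_def_field, hexp]
    field_simp
    ring
  have hT := Complex.norm_exp_sub_sum_le_norm_mul_exp ((z - μ) * x) 2
  simp only [Finset.sum_range_succ, Finset.range_zero, Finset.sum_empty, pow_zero, pow_one,
    Nat.factorial, Nat.cast_one, zero_add, mul_one, div_one, norm_mul, Complex.norm_real,
    Real.norm_of_nonneg hx] at hT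
  have hμ : ‖Complex.exp (μ * x)‖ = Real.exp (μ.re * x) := by
    rw [Complex.norm_exp]; simp
  have hpos : 0 < ‖z - μ‖ := norm_pos_iff.mpr hne
  rw [heq, norm_mul, norm_mul, norm_inv, hμ]
  calc _ ≤ ‖z - μ‖⁻¹ * (Real.exp (μ.re * x) *
        ((‖z - μ‖ * x) ^ 2 * Real.exp (‖z - μ‖ * x))) := by gcongr
    _ = _ := by
      rw [add_mul, Real.exp_add]
      field_simp

/-- For `δ > 0`, `r ∈ ℕ`, `b ∈ L_∞(ℝ)` and `1 ≤ p < ∞`, the family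
of weighted causal operators
`(K_μ φ)(t) = e^{-δ|t|} ∫_{-∞}^t e^{μ(t-s)}(t-s)^r e^{-δ|s|} b(s) φ(s) ds`
is analytic in `μ` (complex differentiable in the operator norm) on the half-plane
`{μ : Re μ < δ}`: any operator-valued function realizing these formulas is
differentiable there. -/
theorem statement12 (δ : ℝ) (hδ : 0 < δ) (r : ℕ)
    (b : Lp ℂ ⊤ (volume : Measure ℝ))
    (p : ENNReal) [Fact (1 ≤ p)] (hp2 : p ≠ ⊤)
    (K : ℂ → (Lp ℂ p (volume : Measure ℝ) →L[ℂ] Lp ℂ p (volume : Measure ℝ)))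
    (hK : ∀ μ : ℂ, μ.re < δ → ∀ φ : Lp ℂ p (volume : Measure ℝ),
      ∀ᵐ t : ℝ ∂volume,
        (K μ φ : ℝ → ℂ) t = (Real.exp (-δ * |t|) : ℂ) * ∫ s in Set.Iic t,
          Complex.exp (μ * ((t : ℂ) - (s : ℂ))) * ((t : ℂ) - (s : ℂ)) ^ r *
            (Real.exp (-δ * |s|) : ℂ) * (b : ℝ → ℂ) s * (φ : ℝ → ℂ) s) :
    DifferentiableOn ℂ K {μ : ℂ | μ.re < δ} := by
  intro μ hμ
  have hμ' : μ.re < δ := hμ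
  obtain ⟨a, hμa, haδ⟩ : ∃ a, max μ.re 0 < a ∧ a < δ := exists_between (max_lt hμ' hδ)
  have ha0 : 0 ≤ a := (le_max_right _ _).trans hμa.le
  have hμa' : μ.re < a := (le_max_left _ _).trans_lt hμa
  set η : ℝ := (a - μ.re) / 2 with hη
  have hη0 : 0 < η := by rw [hη]; linarith
  obtain ⟨N, hN0, hN⟩ := exists_opNorm_causal_le ha0 haδ b p
  obtain ⟨C, hC0, hC⟩ := exists_pow_mul_exp_le (show μ.re + η < a by rw [hη]; linarith) (r + 2)
  obtain ⟨C₀, hC₀0, hC₀⟩ := exists_pow_mul_exp_le (show μ.re + η < a by rw [hη]; linarith) r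
  let f : ℂ → ℝ → ℂ := fun z x => Complex.exp (z * x) * (x : ℂ) ^ r
  have hfcont : ∀ z, Continuous (f z) := fun z => by fun_prop
  have hre : ∀ z : ℂ, ‖z - μ‖ < η → z.re ≤ μ.re + η := fun z hz => by
    have := (Complex.re_le_norm (z - μ)).trans hz.le
    rw [Complex.sub_re] at this
    linarith
  have hfle : ∀ z, ‖z - μ‖ < η → ∀ x, 0 ≤ x → ‖f z x‖ ≤ C₀ * Real.exp (a * x) := by
    intro z hz x hx
    refine le_trans (le_of_eq_of_le ?_ (?_ : x ^ r * Real.exp (z.re * x) ≤ _)) (hC₀ x hx)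
    · simp only [f, norm_mul, norm_pow, Complex.norm_real, Real.norm_of_nonneg hx,
        Complex.norm_exp]
      simp [mul_comm]
    · gcongr
      exact hre z hz
  have hKf : ∀ z, ‖z - μ‖ < η → ∀ φ, ∀ᵐ t : ℝ, K z φ t =
      (Real.exp (-δ * |t|) : ℂ) * ∫ s in Set.Iic t, causalIntegrand δ b (f z) φ t s := by
    intro z hz φ
    have hzδ : z.re < δ := (hre z hz).trans_lt (by rw [hη]; linarith)
    filter_upwards [hK z hzδ φ] with t ht
    simpa only [causalIntegrand, f, Complex.ofReal_sub] using ht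
  have hslope : ∀ z, ‖z - μ‖ < η → ∀ φ : Lp ℂ p (volume : Measure ℝ), ∀ᵐ t : ℝ,
      IntegrableOn (causalIntegrand δ b (fun x => slope (fun w => f w x) μ z) φ t)
        (Set.Iic t) volume ∧
      slope K μ z φ t = (Real.exp (-δ * |t|) : ℂ) * ∫ s in Set.Iic t,
        causalIntegrand δ b (fun x => slope (fun w => f w x) μ z) φ t s := by
    intro z hz φ
    have hμη : ‖μ - μ‖ < η := by simpa using hη0
    have hsl : slope K μ z φ = (z - μ)⁻¹ • (K z φ - K μ φ) := rfl
    rw [hsl]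
    filter_upwards [hKf z hz φ, hKf μ hμη φ, Lp.coeFn_smul (z - μ)⁻¹ (K z φ - K μ φ),
      Lp.coeFn_sub (K z φ) (K μ φ)] with t h1 h2 h3 h4
    have hi1 := integrableOn_causalIntegrand (b := b) ha0 haδ hC₀0 (hfcont z) (hfle z hz) φ t
    have hi2 := integrableOn_causalIntegrand (b := b) ha0 haδ hC₀0 (hfcont μ) (hfle μ hμη) φ t
    have heq : ∀ s, causalIntegrand δ b (fun x => slope (fun w => f w x) μ z) φ t s =
        (z - μ)⁻¹ * (causalIntegrand δ b (f z) φ t s - causalIntegrand δ b (f μ) φ t s) := by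
      intro s
      simp only [causalIntegrand, slope, vsub_eq_sub, smul_eq_mul]
      ring
    rw [funext heq]
    refine ⟨(hi1.sub hi2).const_mul _, ?_⟩
    rw [integral_const_mul, integral_sub hi1 hi2, h3, Pi.smul_apply, h4, Pi.sub_apply, h1, h2,
      smul_eq_mul]
    ring
  have hslope_le : ∀ z, z ≠ μ → ‖z - μ‖ < η → ∀ x, 0 ≤ x →
      ‖slope (fun w => f w x) μ z - x * Complex.exp (μ * x) * (x : ℂ) ^ r‖ ≤
        ‖z - μ‖ * C * Real.exp (a * x) := by
    intro z hz hzη x hx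
    have heq : slope (fun w => f w x) μ z - x * Complex.exp (μ * x) * (x : ℂ) ^ r =
        (slope (fun w : ℂ => Complex.exp (w * x)) μ z - x * Complex.exp (μ * x)) * (x : ℂ) ^ r := by
      simp only [f, slope, vsub_eq_sub, smul_eq_mul]
      ring
    rw [heq, norm_mul, norm_pow, Complex.norm_real, Real.norm_of_nonneg hx]
    calc _ ≤ ‖z - μ‖ * (x ^ 2 * Real.exp ((μ.re + ‖z - μ‖) * x)) * x ^ r := by
          gcongr
          exact norm_slope_exp_sub_le hz hx
      _ ≤ ‖z - μ‖ * (x ^ 2 * Real.exp ((μ.re + η) * x)) * x ^ r := by gcongr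
      _ = ‖z - μ‖ * (x ^ (r + 2) * Real.exp ((μ.re + η) * x)) := by ring
      _ ≤ ‖z - μ‖ * (C * Real.exp (a * x)) := mul_le_mul_of_nonneg_left (hC x hx) (norm_nonneg _)
      _ = _ := by ring
  have hdist : ∀ z w, z ≠ μ → ‖z - μ‖ < η → w ≠ μ → ‖w - μ‖ < η →
      ‖slope K μ z - slope K μ w‖ ≤ (‖z - μ‖ + ‖w - μ‖) * C * N := by
    intro z w hz hzη hw hwη
    refine hN _ (fun x => slope (fun v => f v x) μ z - slope (fun v => f v x) μ w) _
      (by positivity) (fun x hx => ?_) (fun φ => ?_)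
    · rw [← sub_sub_sub_cancel_right _ _ (x * Complex.exp (μ * x) * (x : ℂ) ^ r)]
      refine (norm_sub_le _ _).trans ?_
      linarith [hslope_le z hz hzη x hx, hslope_le w hw hwη x hx]
    · rw [sub_apply]
      filter_upwards [hslope z hzη φ, hslope w hwη φ,
        Lp.coeFn_sub (slope K μ z φ) (slope K μ w φ)] with t h1 h2 h3
      rw [h3, Pi.sub_apply, h1.2, h2.2, ← mul_sub, ← integral_sub h1.1 h2.1]
      simp only [causalIntegrand, sub_mul]
  have hcauchy : Cauchy (map (slope K μ) (𝓝[≠] μ)) := by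
    rw [Metric.cauchy_iff]
    refine ⟨inferInstance, fun ε hε => ?_⟩
    set ρ : ℝ := min η (ε / (2 * (C * N + 1)))
    have hρ0 : 0 < ρ := by positivity
    refine ⟨slope K μ '' (Metric.ball μ ρ ∩ {μ}ᶜ),
      image_mem_map (inter_mem (mem_nhdsWithin_of_mem_nhds (Metric.ball_mem_nhds μ hρ0))
        self_mem_nhdsWithin), ?_⟩
    rintro _ ⟨z, ⟨hz, hzμ⟩, rfl⟩ _ ⟨w, ⟨hw, hwμ⟩, rfl⟩
    rw [Metric.mem_ball, dist_eq_norm] at hz hw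
    rw [dist_eq_norm]
    have hρε : ρ * (2 * (C * N + 1)) ≤ ε :=
      (le_div_iff₀ (by positivity)).mp (min_le_right _ _)
    calc _ ≤ (‖z - μ‖ + ‖w - μ‖) * C * N :=
          hdist z w hzμ (hz.trans_le (min_le_left _ _)) hwμ (hw.trans_le (min_le_left _ _))
      _ ≤ (ρ + ρ) * C * N := by gcongr
      _ < ρ * (2 * (C * N + 1)) := by linarith
      _ ≤ ε := hρε
  obtain ⟨K', hK'⟩ := cauchy_map_iff_exists_tendsto.mp hcauchy
  exact (hasDerivAt_iff_tendsto_slope.mpr hK').differentiableAt.differentiableWithinAt
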